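/- arXiv:2309.09871 — 2 statements merged into one kernel-verified Lean document; each statement's English description precedes it below -/
import Mathlib

section
/- Let 0 < H < 1/2 and T > 0. For every δ > 0 and all s,t with t > δ, t − δ < s < t and t ≤ T: s^{−2H}·|Δℓ(δ,s,t)| ≤ 2 + (2T)^{2H}. -/
open Real

/-- `ℓ(x) = |1+x|^{2H} − |1−x|^{2H}`. -/
noncomputable def ell (H x : ℝ) : ℝ := |1 + x| ^ (2*H) - |1 - x| ^ (2*H)

/-- `Δℓ(δ,s,t) = (t^{2H}/2)·ℓ(δ/t) − ((t−s)^{2H}/2)·ℓ(δ/(t−s))`. -/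
noncomputable def deltaEll (H δ s t : ℝ) : ℝ :=
  (t ^ (2*H) / 2) * ell H (δ / t) - ((t - s) ^ (2*H) / 2) * ell H (δ / (t - s))

theorem rpow_mul_ell {x : ℝ} (hx : 0 < x) (H δ : ℝ) :
    x ^ (2*H) * ell H (δ / x) = |x + δ| ^ (2*H) - |x - δ| ^ (2*H) := by
  have scale (y : ℝ) : x ^ (2*H) * |y| ^ (2*H) = |x * y| ^ (2*H) := by
    rw [abs_mul, abs_of_pos hx, mul_rpow hx.le (abs_nonneg y)]
  have hp : x * (1 + δ / x) = x + δ := by field_simp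
  have hm : x * (1 - δ / x) = x - δ := by field_simp
  rw [ell, mul_sub, scale, scale, hp, hm]

theorem abs_deltaEll_le_rpow {H δ s t : ℝ} (h0 : 0 < H) (h1 : H < 1/2) (hδ : 0 < δ)
    (hδt : δ < t) (hs : t - δ < s) (hst : s < t) : |deltaEll H δ s t| ≤ s ^ (2*H) := by
  have ha : 0 ≤ 2 * H := by linarith
  have ht : 0 < t := hδ.trans hδt
  have hts : 0 < t - s := sub_pos.2 hst
  have hs0 : 0 < s := by linarith
  have e : deltaEll H δ s t = ((t + δ) ^ (2*H) - (t - s + δ) ^ (2*H)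
      + ((δ - (t - s)) ^ (2*H) - (t - δ) ^ (2*H))) / 2 := by
    have e₁ := rpow_mul_ell ht H δ
    have e₂ := rpow_mul_ell hts H δ
    rw [abs_of_pos (by linarith), abs_of_pos (by linarith)] at e₁
    rw [abs_of_pos (by linarith), abs_sub_comm, abs_of_pos (by linarith)] at e₂
    rw [deltaEll]
    linarith
  have subadd : (t + δ) ^ (2*H) ≤ (t - s + δ) ^ (2*H) + s ^ (2*H) := by
    have h := rpow_add_le_add_rpow (a := t - s + δ) (b := s) (p := 2*H)
      (by linarith) hs0.le ha (by linarith)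
    rwa [show t - s + δ + s = t + δ by ring] at h
  have mono₁ : (t - s + δ) ^ (2*H) ≤ (t + δ) ^ (2*H) :=
    rpow_le_rpow (by linarith) (by linarith) ha
  have mono₂ : (δ - (t - s)) ^ (2*H) ≤ s ^ (2*H) :=
    rpow_le_rpow (by linarith) (by linarith) ha
  have mono₃ : (t - δ) ^ (2*H) ≤ s ^ (2*H) :=
    rpow_le_rpow (by linarith) hs.le ha
  have nonneg₁ : 0 ≤ (δ - (t - s)) ^ (2*H) := rpow_nonneg (by linarith) _
  have nonneg₂ : 0 ≤ (t - δ) ^ (2*H) := rpow_nonneg (by linarith) _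
  rw [e, abs_le]
  constructor <;> linarith

theorem deltaEll_near_diagonal_bound (H T : ℝ) (h0 : 0 < H) (h1 : H < 1/2) (hT : 0 < T) :
    ∀ δ > (0:ℝ), ∀ s t : ℝ, δ < t → t - δ < s → s < t → t ≤ T →
      s ^ (-(2*H)) * |deltaEll H δ s t| ≤ 2 + (2*T) ^ (2*H) := by
  intro δ hδ s t hδt hs hst _
  have hs0 : 0 < s := by linarith
  have hT' : 0 ≤ (2*T) ^ (2*H) := by positivity
  calc s ^ (-(2*H)) * |deltaEll H δ s t|
      ≤ s ^ (-(2*H)) * s ^ (2*H) := by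
        gcongr
        exact abs_deltaEll_le_rpow h0 h1 hδ hδt hs hst
    _ = 1 := by rw [← rpow_add hs0, neg_add_cancel, rpow_zero]
    _ ≤ 2 + (2*T) ^ (2*H) := by linarith
end

section
/- Let 0 < H < 1/2 and T > 0. Define φ(s,t) := R(s,t) − s^{2H}, Θ_{s,t} := s^{2H}·t^{2H} − R(s,t)², η₁₁(s,t) := H·( s^{2H−1}·(t−s)^{2H} − φ(s,t)·(t−s)^{2H−1} )/Θ_{s,t} and η₂₁(s,t) := H·( ( t^{2H−1} − (t−s)^{2H−1} )·(t−s)^{2H} − φ(s,t)·(t−s)^{2H−1} )/Θ_{s,t}. Then there exists a constant C > 0, depending only on H and T, such that for all 0 < s < t ≤ T: |η₁₁(s,t)·η₂₁(s,t)|·s^{2H} ≤ C·( (t−s)^{2H−2} + s^{H−1}·(t−s)^{H−1} + (t−s)^{2H−1}/t + t^{−2H}·(t−s)^{2H−1} ). -/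
open Real

/-- Covariance of fractional Brownian motion with Hurst parameter `H`. -/
noncomputable def fbmR (H s t : ℝ) : ℝ := (t ^ (2*H) + s ^ (2*H) - |t - s| ^ (2*H)) / 2

/-- `φ(s,t) = R(s,t) − s^{2H}`. -/
noncomputable def fbmPhi (H s t : ℝ) : ℝ := fbmR H s t - s ^ (2*H)

/-- `Θ_{s,t} = s^{2H}·t^{2H} − R(s,t)²`. -/
noncomputable def fbmTheta (H s t : ℝ) : ℝ := s ^ (2*H) * t ^ (2*H) - (fbmR H s t) ^ 2

/-- `η₁₁(s,t) = H·( s^{2H−1}·(t−s)^{2H} − φ(s,t)·(t−s)^{2H−1} )/Θ_{s,t}`. -/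
noncomputable def eta11 (H s t : ℝ) : ℝ :=
  H * (s ^ (2*H - 1) * (t - s) ^ (2*H) - fbmPhi H s t * (t - s) ^ (2*H - 1)) / fbmTheta H s t

/-- `η₂₁(s,t) = H·( ( t^{2H−1} − (t−s)^{2H−1} )·(t−s)^{2H} − φ(s,t)·(t−s)^{2H−1} )/Θ_{s,t}`. -/
noncomputable def eta21 (H s t : ℝ) : ℝ :=
  H * ((t ^ (2*H - 1) - (t - s) ^ (2*H - 1)) * (t - s) ^ (2*H)
    - fbmPhi H s t * (t - s) ^ (2*H - 1)) / fbmTheta H s t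

/-- For positive increments, `|φ(s,t)| ≤ min(s^{2H}, (t−s)^{2H})/2`. -/
lemma abs_fbmPhi_le {H s t : ℝ} (h0 : 0 < H) (h1 : H < 1/2) (hs : 0 < s) (hst : s < t) :
    |fbmPhi H s t| ≤ min (s ^ (2*H)) ((t - s) ^ (2*H)) / 2 := by
  have hr : 0 < t - s := sub_pos.2 hst
  have hsub : t ^ (2*H) ≤ s ^ (2*H) + (t - s) ^ (2*H) := by
    simpa using Real.rpow_add_le_add_rpow hs.le hr.le (p := 2*H) (by linarith) (by linarith)
  have hts : s ^ (2*H) ≤ t ^ (2*H) := by gcongr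
  have htr : (t - s) ^ (2*H) ≤ t ^ (2*H) := by gcongr; linarith
  have hφ : fbmPhi H s t = (t ^ (2*H) - s ^ (2*H) - (t - s) ^ (2*H)) / 2 := by
    rw [fbmPhi, fbmR, abs_of_pos hr]; ring
  rw [hφ, abs_of_nonpos (by linarith), le_div_iff₀ two_pos, le_min_iff]
  constructor <;> linarith

lemma le_fbmTheta {H s t : ℝ} (h0 : 0 < H) (h1 : H < 1/2) (hs : 0 < s) (hst : s < t) :
    3 / 4 * (s ^ (2*H) * (t - s) ^ (2*H)) ≤ fbmTheta H s t := by
  have hr : 0 < t - s := sub_pos.2 hst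
  have hB := rpow_pos_of_pos hs (2*H)
  have hD := rpow_pos_of_pos hr (2*H)
  have hΘ : fbmTheta H s t = s ^ (2*H) * (t - s) ^ (2*H) - |fbmPhi H s t| ^ 2 := by
    rw [sq_abs, fbmTheta, fbmPhi, fbmR, abs_of_pos hr]; ring
  have hφ := abs_fbmPhi_le h0 h1 hs hst
  have h2 : |fbmPhi H s t| * |fbmPhi H s t| ≤ s ^ (2*H) / 2 * ((t - s) ^ (2*H) / 2) := by
    gcongr
    · exact hφ.trans (by gcongr; exact min_le_left _ _)
    · exact hφ.trans (by gcongr; exact min_le_right _ _)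
  rw [hΘ]
  nlinarith

lemma abs_eta11_le {H s t : ℝ} (h0 : 0 < H) (h1 : H < 1/2) (hs : 0 < s) (hst : s < t) :
    |eta11 H s t| ≤
      4 / 3 * H * (1 / s + min (s ^ (2*H)) ((t - s) ^ (2*H)) / (2 * (t - s) * s ^ (2*H))) := by
  have hr : 0 < t - s := sub_pos.2 hst
  have hB := rpow_pos_of_pos hs (2*H)
  have hD := rpow_pos_of_pos hr (2*H)
  have hφ := abs_fbmPhi_le h0 h1 hs hst
  have hΘ := le_fbmTheta h0 h1 hs hst
  have hΘ0 : 0 < fbmTheta H s t := lt_of_lt_of_le (by positivity) hΘ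
  rw [eta11, abs_div, abs_mul, abs_of_pos h0, abs_of_pos hΘ0, rpow_sub_one hs.ne',
    rpow_sub_one hr.ne', div_le_iff₀ hΘ0]
  set B := s ^ (2*H)
  set D := (t - s) ^ (2*H)
  set m := min B D
  have hm : 0 < m := lt_min hB hD
  calc H * |B / s * D - fbmPhi H s t * (D / (t - s))|
      ≤ H * (B / s * D + m / 2 * (D / (t - s))) := by
        gcongr
        refine (abs_sub _ _).trans ?_
        rw [abs_mul (fbmPhi H s t), abs_of_pos (by positivity : 0 < D / (t - s)),
          abs_of_pos (by positivity : 0 < B / s * D)]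
        gcongr
    _ = 4 / 3 * H * (1 / s + m / (2 * (t - s) * B)) * (3 / 4 * (B * D)) := by
        field_simp
    _ ≤ _ := by gcongr

lemma abs_eta21_le {H s t : ℝ} (h0 : 0 < H) (h1 : H < 1/2) (hs : 0 < s) (hst : s < t) :
    |eta21 H s t| ≤
      2 * H * (min (s ^ (2*H)) ((t - s) ^ (2*H)) / ((t - s) * s ^ (2*H))) := by
  have hr : 0 < t - s := sub_pos.2 hst
  have ht : 0 < t := hs.trans hst
  have hB := rpow_pos_of_pos hs (2*H)
  have hD := rpow_pos_of_pos hr (2*H)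
  have hφ := abs_fbmPhi_le h0 h1 hs hst
  have hΘ := le_fbmTheta h0 h1 hs hst
  have hΘ0 : 0 < fbmTheta H s t := lt_of_lt_of_le (by positivity) hΘ
  have htr : t ^ (2*H - 1) ≤ (t - s) ^ (2*H - 1) :=
    rpow_le_rpow_of_nonpos hr (by linarith) (by linarith)
  have hts : t ^ (2*H - 1) ≤ s ^ (2*H - 1) :=
    rpow_le_rpow_of_nonpos hs hst.le (by linarith)
  have ht1 : 0 < t ^ (2*H - 1) := rpow_pos_of_pos ht _
  have hrt : (t - s) ^ (2*H) ≤ t ^ (2*H) := by gcongr; linarith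
  have hdiff : |t ^ (2*H - 1) - (t - s) ^ (2*H - 1)|
      ≤ min (s ^ (2*H)) ((t - s) ^ (2*H)) / (t - s) := by
    rw [abs_of_nonpos (by linarith), le_div_iff₀ hr, le_min_iff]
    have e1 : s ^ (2*H - 1) * s = s ^ (2*H) := by rw [rpow_sub_one hs.ne']; field_simp
    have e2 : (t - s) ^ (2*H - 1) * (t - s) = (t - s) ^ (2*H) := by
      rw [rpow_sub_one hr.ne', div_mul_cancel₀ _ hr.ne']
    have e3 : t ^ (2*H - 1) * t = t ^ (2*H) := by rw [rpow_sub_one ht.ne']; field_simp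
    have h3 := mul_le_mul_of_nonneg_right hts hs.le
    have h4 := mul_pos ht1 hr
    constructor <;> linarith
  rw [eta21, abs_div, abs_mul, abs_of_pos h0, abs_of_pos hΘ0, div_le_iff₀ hΘ0]
  set d := t ^ (2*H - 1) - (t - s) ^ (2*H - 1)
  rw [rpow_sub_one hr.ne']
  set B := s ^ (2*H)
  set D := (t - s) ^ (2*H)
  set m := min B D
  have hm : 0 < m := lt_min hB hD
  calc H * |d * D - fbmPhi H s t * (D / (t - s))|
      ≤ H * (m / (t - s) * D + m / 2 * (D / (t - s))) := by
        gcongr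
        refine (abs_sub _ _).trans ?_
        rw [abs_mul, abs_mul, abs_of_pos (by positivity : 0 < D / (t - s)), abs_of_pos hD]
        gcongr
    _ = 2 * H * (m / ((t - s) * B)) * (3 / 4 * (B * D)) := by
        field_simp; ring
    _ ≤ _ := by gcongr

/-- The two homogeneous terms alone dominate, with constant `4H²` and without any bound on `t`. -/
lemma abs_eta11_mul_eta21_mul_le {H s t : ℝ} (h0 : 0 < H) (h1 : H < 1/2) (hs : 0 < s)
    (hst : s < t) :
    |eta11 H s t * eta21 H s t| * s ^ (2*H)
      ≤ 4 * H ^ 2 * ((t - s) ^ (2*H - 2) + s ^ (H - 1) * (t - s) ^ (H - 1)) := by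
  have hr : 0 < t - s := sub_pos.2 hst
  have hη₁ := abs_eta11_le h0 h1 hs hst
  have hη₂ := abs_eta21_le h0 h1 hs hst
  have hB := rpow_pos_of_pos hs (2*H)
  have hD := rpow_pos_of_pos hr (2*H)
  have e1 : (t - s) ^ (2*H - 2) = (t - s) ^ (2*H) / (t - s) ^ 2 := by
    rw [rpow_sub hr, rpow_two]
  rw [abs_mul, mul_add]
  rcases le_total s (t - s) with h | h
  · have hm : s ^ (2*H) ≤ (t - s) ^ (2*H) := by gcongr
    rw [min_eq_left hm] at hη₁ hη₂
    have hη₁' : |eta11 H s t| ≤ 2 * H / s := by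
      calc _ ≤ _ := hη₁
        _ = 4 / 3 * H * (1 / s + 1 / (2 * (t - s))) := by field_simp
        _ ≤ 4 / 3 * H * (1 / s + 1 / (2 * s)) := by gcongr
        _ = _ := by field_simp; ring
    have hη₂' : |eta21 H s t| ≤ 2 * H / (t - s) := hη₂.trans_eq (by field_simp)
    have hsH : s ^ (2*H) ≤ s ^ H * (t - s) ^ H := by
      rw [two_mul, rpow_add hs]; gcongr
    calc |eta11 H s t| * |eta21 H s t| * s ^ (2*H)
        ≤ 2 * H / s * (2 * H / (t - s)) * (s ^ H * (t - s) ^ H) := by gcongr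
      _ = 4 * H ^ 2 * (s ^ (H - 1) * (t - s) ^ (H - 1)) := by
        rw [rpow_sub_one hs.ne', rpow_sub_one hr.ne']; field_simp; ring
      _ ≤ _ := le_add_of_nonneg_left (by positivity)
  · have hm : (t - s) ^ (2*H) ≤ s ^ (2*H) := by gcongr
    rw [min_eq_right hm] at hη₁ hη₂
    have hη₁' : |eta11 H s t| ≤ 2 * H / (t - s) := by
      calc _ ≤ _ := hη₁
        _ ≤ 4 / 3 * H * (1 / (t - s) + s ^ (2*H) / (2 * (t - s) * s ^ (2*H))) := by gcongr
        _ = _ := by field_simp; ring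
    calc |eta11 H s t| * |eta21 H s t| * s ^ (2*H)
        ≤ 2 * H / (t - s) * (2 * H * ((t - s) ^ (2*H) / ((t - s) * s ^ (2*H)))) * s ^ (2*H) := by
          gcongr
      _ = 4 * H ^ 2 * (t - s) ^ (2*H - 2) := by
        rw [e1]; field_simp; ring
      _ ≤ _ := le_add_of_nonneg_right (by positivity)

theorem eta11_eta21_bound (H T : ℝ) (h0 : 0 < H) (h1 : H < 1/2) (hT : 0 < T) :
    ∃ C > 0, ∀ s t : ℝ, 0 < s → s < t → t ≤ T →
      |eta11 H s t * eta21 H s t| * s ^ (2*H)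
        ≤ C * ((t - s) ^ (2*H - 2) + s ^ (H - 1) * (t - s) ^ (H - 1)
          + (t - s) ^ (2*H - 1) / t + t ^ (-(2*H)) * (t - s) ^ (2*H - 1)) := by
  refine ⟨4 * H ^ 2, by positivity, fun s t hs hst _ => ?_⟩
  have hr : 0 < t - s := sub_pos.2 hst
  have ht : 0 < t := hs.trans hst
  refine (abs_eta11_mul_eta21_mul_le h0 h1 hs hst).trans ?_
  refine mul_le_mul_of_nonneg_left ?_ (by positivity)
  rw [add_assoc (_ + _) (_ / t)]
  exact le_add_of_nonneg_right (by positivity)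
end
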